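/- arXiv:1803.04036 — 3 statements merged into one kernel-verified Lean document; each statement's English description precedes it below -/
import Mathlib

section
/- Let A be a unital C*-algebra, n a positive integer, and let g, h be positive invertible elements of M_n(A). Then for every X ∈ Aⁿ, (1/‖√h·√(g⁻¹)‖_{M_n(A)})·N_h(X) ≤ N_g(X) ≤ ‖√g·√(h⁻¹)‖_{M_n(A)}·N_h(X); in particular the norms N_g and N_h on Aⁿ are equivalent. -/
open Matrix

/-- The `g`-inner product `⟨X|Y⟩_g = ∑_{j,k} X_j g_{jk} (Y_k)*` on `Aⁿ`,
for a matrix `g` with entries in a C*-algebra `A`. -/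
noncomputable def gInner {A : Type*} [CStarAlgebra A] {n : ℕ}
    (g : Matrix (Fin n) (Fin n) A) (X Y : Fin n → A) : A :=
  ∑ j, ∑ k, X j * g j k * star (Y k)

/-- The `g`-norm `N_g(X) = ‖⟨X|X⟩_g‖^{1/2}` on `Aⁿ`. -/
noncomputable def gNorm {A : Type*} [CStarAlgebra A] {n : ℕ}
    (g : Matrix (Fin n) (Fin n) A) (X : Fin n → A) : ℝ :=
  Real.sqrt ‖gInner g X X‖

/-- The standard norm `‖X‖_st = ‖∑_j X_j (X_j)*‖^{1/2}` on `Aⁿ`. -/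
noncomputable def stNorm {A : Type*} [CStarAlgebra A] {n : ℕ}
    (X : Fin n → A) : ℝ :=
  Real.sqrt ‖∑ j, X j * star (X j)‖

/-- The (unique) C*-norm of a matrix `m ∈ Mₙ(A)`, realized as the operator norm
of the right-multiplication action `X ↦ X·m` on the standard Hilbert
`A`-module `Aⁿ`. -/
noncomputable def matNorm {A : Type*} [CStarAlgebra A] {n : ℕ}
    (m : Matrix (Fin n) (Fin n) A) : ℝ :=
  sInf {c : ℝ | 0 ≤ c ∧ ∀ X : Fin n → A, stNorm (X ᵥ* m) ≤ c * stNorm X}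

section Auxiliary

variable {A : Type*} [CStarAlgebra A] {n : ℕ}

attribute [local instance] CStarAlgebra.spectralOrder CStarAlgebra.spectralOrderedRing

lemma stNorm_eq_norm (X : Fin n → A) :
    stNorm X = ‖(WithCStarModule.equiv A (Fin n → A)).symm X‖ := by
  simp [stNorm, WithCStarModule.pi_norm, WithCStarModule.inner_def]

lemma matNorm_eq_norm (m : Matrix (Fin n) (Fin n) A) :
    matNorm m = ‖CStarMatrix.ofMatrix m‖ := by
  rw [CStarMatrix.norm_def, ContinuousLinearMap.norm_def, matNorm]
  rfl

lemma stNorm_vecMul_le (X : Fin n → A) (m : Matrix (Fin n) (Fin n) A) :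
    stNorm (X ᵥ* m) ≤ matNorm m * stNorm X := by
  rw [matNorm_eq_norm, stNorm_eq_norm, stNorm_eq_norm, CStarMatrix.norm_def]
  exact (CStarMatrix.toCLM (CStarMatrix.ofMatrix m)).le_opNorm _

lemma gNorm_eq_stNorm_vecMul {g s : Matrix (Fin n) (Fin n) A} (hs : s.IsHermitian)
    (hsg : s * s = g) (X : Fin n → A) : gNorm g X = stNorm (X ᵥ* s) := by
  have hinner : gInner g X X = (X ᵥ* g) ⬝ᵥ star X := by
    simp only [gInner, dotProduct, vecMul, Finset.sum_mul, Pi.star_apply]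
    exact Finset.sum_comm
  have hst : ∑ j, (X ᵥ* s) j * star ((X ᵥ* s) j) = (X ᵥ* s) ⬝ᵥ star (X ᵥ* s) := rfl
  rw [gNorm, stNorm, hst, star_vecMul, hs.eq, dotProduct_mulVec, vecMul_vecMul, hsg, hinner]

lemma matNorm_eq_of_conjTranspose_mul_self {u v : Matrix (Fin n) (Fin n) A}
    (huv : uᴴ * u = v * vᴴ) : matNorm u = matNorm v := by
  have h : star (CStarMatrix.ofMatrix u) * CStarMatrix.ofMatrix u =
      CStarMatrix.ofMatrix v * star (CStarMatrix.ofMatrix v) :=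
    congrArg CStarMatrix.ofMatrix huv
  rw [matNorm_eq_norm, matNorm_eq_norm,
    ← mul_self_inj_of_nonneg (norm_nonneg _) (norm_nonneg _),
    ← CStarRing.norm_star_mul_self, ← CStarRing.norm_self_mul_star, h]

lemma stNorm_vecMul_le_matNorm_mul {s t ti hi : Matrix (Fin n) (Fin n) A}
    (hs : s.IsHermitian) (ht : t.IsHermitian) (hti : ti.IsHermitian)
    (hthi : t * t * hi = 1) (hti2 : ti * ti = hi) (X : Fin n → A) :
    stNorm (X ᵥ* s) ≤ matNorm (s * ti) * stNorm (X ᵥ* t) := by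
  have hhi : hiᴴ = hi := by rw [← hti2, conjTranspose_mul, hti.eq]
  have hu : matNorm (t * hi * s) = matNorm (s * ti) := by
    apply matNorm_eq_of_conjTranspose_mul_self
    calc (t * hi * s)ᴴ * (t * hi * s) = s * hi * (t * t * hi) * s := by
          simp only [conjTranspose_mul, hs.eq, ht.eq, hhi, mul_assoc]
      _ = s * ti * (s * ti)ᴴ := by
          rw [hthi, conjTranspose_mul, hs.eq, hti.eq, ← hti2]
          simp only [mul_assoc, mul_one]
  have hX : X ᵥ* s = (X ᵥ* t) ᵥ* (t * hi * s) := by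
    rw [vecMul_vecMul, ← mul_assoc, ← mul_assoc, hthi, one_mul]
  rw [hX, ← hu]
  exact stNorm_vecMul_le _ _

lemma matNorm_nonneg (m : Matrix (Fin n) (Fin n) A) : 0 ≤ matNorm m :=
  Real.sInf_nonneg fun _ hc => hc.1

end Auxiliary

/-- For positive invertible matrices `g, h ∈ Mₙ(A)`, with `gi = g⁻¹`, `hi = h⁻¹`
and positive square roots `sg = √g`, `sh = √h`, `sgi = √(g⁻¹)`, `shi = √(h⁻¹)`,
one has `(1/‖√h·√(g⁻¹)‖) N_h(X) ≤ N_g(X) ≤ ‖√g·√(h⁻¹)‖ N_h(X)` for all `X ∈ Aⁿ`;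
in particular the norms `N_g` and `N_h` are equivalent. -/
theorem gNorm_equiv {A : Type*} [CStarAlgebra A]
    {n : ℕ} (hn : 0 < n)
    (g h gi hi sg sh sgi shi : Matrix (Fin n) (Fin n) A)
    (hg : ∃ m : Matrix (Fin n) (Fin n) A, g = mᴴ * m)
    (hh : ∃ m : Matrix (Fin n) (Fin n) A, h = mᴴ * m)
    (hgi : g * gi = 1 ∧ gi * g = 1)
    (hhi : h * hi = 1 ∧ hi * h = 1)
    (hsg : (∃ m : Matrix (Fin n) (Fin n) A, sg = mᴴ * m) ∧ sg * sg = g)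
    (hsh : (∃ m : Matrix (Fin n) (Fin n) A, sh = mᴴ * m) ∧ sh * sh = h)
    (hsgi : (∃ m : Matrix (Fin n) (Fin n) A, sgi = mᴴ * m) ∧ sgi * sgi = gi)
    (hshi : (∃ m : Matrix (Fin n) (Fin n) A, shi = mᴴ * m) ∧ shi * shi = hi)
    (X : Fin n → A) :
    (1 / matNorm (sh * sgi)) * gNorm h X ≤ gNorm g X ∧
      gNorm g X ≤ matNorm (sg * shi) * gNorm h X := by
  have herm {s : Matrix (Fin n) (Fin n) A}
      (hs : ∃ m : Matrix (Fin n) (Fin n) A, s = mᴴ * m) : s.IsHermitian := by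
    obtain ⟨m, rfl⟩ := hs
    exact isHermitian_conjTranspose_mul_self m
  have hsg' := herm hsg.1
  have hsh' := herm hsh.1
  rw [gNorm_eq_stNorm_vecMul hsg' hsg.2, gNorm_eq_stNorm_vecMul hsh' hsh.2]
  constructor
  · rw [one_div_mul_eq_div]
    refine div_le_of_le_mul₀ (matNorm_nonneg _) (Real.sqrt_nonneg _) ?_
    rw [mul_comm]
    exact stNorm_vecMul_le_matNorm_mul hsh' hsg' (herm hsgi.1) (hsg.2.symm ▸ hgi.1) hsgi.2 X
  · exact stNorm_vecMul_le_matNorm_mul hsg' hsh' (herm hshi.1) (hsh.2.symm ▸ hhi.1) hshi.2 X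
end

section
/- Let A be a normed ℂ-vector space, B a ℂ-linear subspace of A, and L a seminorm on B which is lower semicontinuous with respect to the norm topology on B induced from A. Let C be the closure in A of {b ∈ B : L(b) ≤ 1}. Then the Minkowski gauge of C extends L: gauge_C(b) = L(b) for every b ∈ B. -/
open Pointwise

/-- The unit ball of a lower semicontinuous seminorm on a subspace is relatively closed in the
subspace: its closure in the ambient space meets the subspace only in the ball itself. -/
theorem Seminorm.coe_mem_closure_image_iff {A : Type*} [NormedAddCommGroup A]
    [NormedSpace ℂ A] {B : Submodule ℂ A} {L : Seminorm ℂ B}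
    (hL : LowerSemicontinuous fun b : B => L b) (b : B) :
    (b : A) ∈ closure ((fun b : B => (b : A)) '' {b : B | L b ≤ 1}) ↔ L b ≤ 1 := by
  have hclosed : IsClosed {b : B | L b ≤ 1} := hL.isClosed_preimage 1
  exact closure_subtype.symm.trans (Set.ext_iff.1 hclosed.closure_eq b)

/-- Let `B` be a subspace of a normed ℂ-vector space `A` and `L` a seminorm on
`B` which is lower semicontinuous for the norm topology induced on `B` from
`A`. Let `C` be the closure in `A` of the unit ball `{b ∈ B : L b ≤ 1}` of
`L`. Then the Minkowski gauge of `C` extends `L`: `gauge C b = L b` for every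
`b ∈ B`. -/
theorem gauge_closure_eq_seminorm {A : Type*} [NormedAddCommGroup A]
    [NormedSpace ℂ A] (B : Submodule ℂ A) (L : Seminorm ℂ B)
    (hL : LowerSemicontinuous fun b : B => L b)
    (C : Set A) (hC : C = closure ((fun b : B => (b : A)) '' {b : B | L b ≤ 1})) :
    ∀ b : B, gauge C (b : A) = L b := by
  intro b
  subst hC
  have key (r : ℝ) (hr : 0 < r) :
      r⁻¹ • (b : A) ∈ closure ((fun b : B => (b : A)) '' {b : B | L b ≤ 1}) ↔ L b ≤ r := by
    have hcoe : r⁻¹ • (b : A) = (((r⁻¹ : ℝ) : ℂ) • b : B) := by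
      rw [Submodule.coe_smul, Complex.coe_smul]
    rw [hcoe, Seminorm.coe_mem_closure_image_iff hL, map_smul_eq_mul, Complex.norm_real,
      Real.norm_of_nonneg (inv_nonneg.2 hr.le), inv_mul_le_one₀ hr]
  rw [gauge_def']
  refine csInf_eq_of_forall_ge_of_forall_gt_exists_lt ?_ ?_ ?_
  · have hpos : 0 < L b + 1 := add_pos_of_nonneg_of_pos (apply_nonneg L b) one_pos
    exact ⟨L b + 1, hpos, (key _ hpos).2 (by linarith)⟩
  · rintro r ⟨hr, h⟩
    exact (key r hr).1 h
  · intro w hw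
    obtain ⟨r, hbr, hrw⟩ := exists_between hw
    have hr : 0 < r := (apply_nonneg L b).trans_lt hbr
    exact ⟨r, ⟨hr, (key r hr).2 hbr.le⟩, hrw⟩
end

section
/- Let A be a normed ℂ-vector space, B a ℂ-linear subspace of A, and L a seminorm on B. Let C be the closure in A of {b ∈ B : L(b) ≤ 1}. Then for every a ∈ A that is absorbed by C (i.e., a ∈ r·C for some r > 0), there exists a sequence (b_k)_{k∈ℕ} in B such that L(b_k) → gauge_C(a) and ‖b_k − a‖_A → 0 as k → ∞. -/
open Pointwise Filter

/-- For `r > 0`, a point lies in `r • closure {b ∈ B : L b ≤ 1}` iff it is a limit of points of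
`{b ∈ B : L b ≤ r}`. -/
theorem Seminorm.mem_smul_closure_unitBall_iff {A : Type*} [NormedAddCommGroup A]
    [NormedSpace ℂ A] {B : Submodule ℂ A} (L : Seminorm ℂ B) {a : A} {r : ℝ} (hr : 0 < r) :
    a ∈ r • closure ((fun b : B => (b : A)) '' {b : B | L b ≤ 1}) ↔
      ∀ δ > 0, ∃ b : B, L b ≤ r ∧ ‖(b : A) - a‖ < δ := by
  have hmap : ∀ {s : ℝ}, 0 < s → ∀ b : B, L ((s : ℂ) • b) = s * L b := fun {s} hs b => by
    rw [map_smul_eq_mul, Complex.norm_real, Real.norm_of_nonneg hs.le]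
  have hset : r • ((fun b : B => (b : A)) '' {b : B | L b ≤ 1}) =
      (fun b : B => (b : A)) '' {b : B | L b ≤ r} := by
    ext x
    rw [Set.mem_smul_set]
    constructor
    · rintro ⟨_, ⟨b, hb, rfl⟩, rfl⟩
      refine ⟨(r : ℂ) • b, ?_, by simp⟩
      rw [Set.mem_ofPred_eq] at hb ⊢
      rw [hmap hr]
      nlinarith
    · rintro ⟨b, hb, rfl⟩
      refine ⟨_, ⟨((r⁻¹ : ℝ) : ℂ) • b, ?_, rfl⟩, ?_⟩
      · rw [Set.mem_ofPred_eq] at hb ⊢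
        rwa [hmap (inv_pos.2 hr), inv_mul_le_one₀ hr]
      · change r • (((r⁻¹ : ℝ) : ℂ) • (b : A)) = b
        rw [Complex.coe_smul, smul_inv_smul₀ hr.ne']
  rw [← closure_smul₀' hr.ne', hset, Metric.mem_closure_iff]
  simp [dist_eq_norm, norm_sub_rev]

/-- Let `B` be a subspace of a normed ℂ-vector space `A`, `L` a seminorm on
`B`, and `C` the closure in `A` of the unit ball `{b ∈ B : L b ≤ 1}` of `L`.
Then for every `a ∈ A` absorbed by `C` (i.e. `a ∈ r • C` for some `r > 0`),
there is a sequence `(b_k)` in `B` with `L (b_k) → gauge C a` and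
`‖b_k − a‖ → 0`. -/
theorem exists_seq_tendsto_gauge {A : Type*} [NormedAddCommGroup A]
    [NormedSpace ℂ A] (B : Submodule ℂ A) (L : Seminorm ℂ B)
    (C : Set A) (hC : C = closure ((fun b : B => (b : A)) '' {b : B | L b ≤ 1}))
    (a : A) (ha : ∃ r : ℝ, 0 < r ∧ a ∈ r • C) :
    ∃ b : ℕ → B,
      Tendsto (fun k => L (b k)) atTop (nhds (gauge C a)) ∧
        Tendsto (fun k => ‖(b k : A) - a‖) atTop (nhds 0) := by
  have hlow : ∀ ε > 0, ∃ δ > 0, ∀ b : B, ‖(b : A) - a‖ < δ → gauge C a - ε < L b := by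
    intro ε hε
    by_contra! h
    obtain ⟨b₀, -, hb₀⟩ := h 1 one_pos
    have hnonneg := apply_nonneg L b₀
    have hr : 0 < gauge C a - ε / 2 := by linarith
    have hmem := (L.mem_smul_closure_unitBall_iff (a := a) hr).2 fun δ hδ => by
      obtain ⟨b, hb, hLb⟩ := h δ hδ
      exact ⟨b, by linarith, hb⟩
    rw [← hC] at hmem
    linarith [gauge_le_of_mem hr.le hmem]
  have happrox : ∀ ε > 0, ∃ b : B, |L b - gauge C a| < ε ∧ ‖(b : A) - a‖ < ε := by
    intro ε hε
    obtain ⟨δ, hδ, hlb⟩ := hlow ε hε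
    obtain ⟨r, ⟨hr, har⟩, hrε⟩ :=
      exists_lt_of_csInf_lt (s := {r : ℝ | 0 < r ∧ a ∈ r • C}) ha
        (show gauge C a < gauge C a + ε by linarith)
    rw [hC, L.mem_smul_closure_unitBall_iff hr] at har
    obtain ⟨b, hLb, hb⟩ := har (min δ ε) (lt_min hδ hε)
    have hlb' := hlb b (hb.trans_le (min_le_left _ _))
    exact ⟨b, abs_lt.2 ⟨by linarith, by linarith⟩, hb.trans_le (min_le_right _ _)⟩
  choose b hLb hb using fun k : ℕ => happrox (1 / ((k : ℝ) + 1)) Nat.one_div_pos_of_nat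
  refine ⟨b, ?_, squeeze_zero (fun _ => norm_nonneg _) (fun k => (hb k).le)
    tendsto_one_div_add_atTop_nhds_zero_nat⟩
  rw [tendsto_iff_dist_tendsto_zero]
  exact squeeze_zero (fun _ => dist_nonneg) (fun k => (hLb k).le)
    tendsto_one_div_add_atTop_nhds_zero_nat
end
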